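/- arXiv:2403.14843 — 8 statements merged into one kernel-verified Lean document; each statement's English description precedes it below -/
import Mathlib

section
/- Let d ≥ 1, let B be a d×d real matrix with all diagonal entries zero, let σ_1,…,σ_d be positive reals, let Ω be the diagonal matrix with entries σ_1²,…,σ_d², and let Θ := (I − B) Ω⁻¹ (I − B)ᵀ. Assume that for every pair of indices j ≠ i, the equality −σ_j⁻² B_{i,j} − σ_i⁻² B_{j,i} + Σ_{ℓ ≠ j,i} σ_ℓ⁻² B_{j,ℓ} B_{i,ℓ} = 0 holds only if B_{i,j} = 0, B_{j,i} = 0, and B_{j,ℓ} B_{i,ℓ} = 0 for every ℓ ≠ j,i. Then for every pair of indices j ≠ i, Θ_{j,i} ≠ 0 if and only if i and j are adjacent in the moral graph of B, i.e., B_{i,j} ≠ 0, or B_{j,i} ≠ 0, or there exists an index ℓ different from i and j with B_{j,ℓ} ≠ 0 and B_{i,ℓ} ≠ 0. -/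
open Matrix Finset

/-- Under the genericity assumption (Assumption 1 of the paper), the support of
`Θ = (I − B) Ω⁻¹ (I − B)ᵀ` coincides exactly with the moral graph of `B`. -/
theorem theta_support_eq_moral_graph (d : ℕ) (hd : 1 ≤ d)
    (B : Matrix (Fin d) (Fin d) ℝ)
    (hBdiag : ∀ i, B i i = 0) (σ : Fin d → ℝ) (hσ : ∀ i, 0 < σ i)
    (Ω : Matrix (Fin d) (Fin d) ℝ) (hΩ : Ω = Matrix.diagonal fun ℓ => σ ℓ ^ 2)
    (Θ : Matrix (Fin d) (Fin d) ℝ) (hΘ : Θ = (1 - B) * Ω⁻¹ * (1 - B)ᵀ)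
    (hgeneric : ∀ j i : Fin d, j ≠ i →
      (-((σ j ^ 2)⁻¹ * B i j) - (σ i ^ 2)⁻¹ * B j i
        + ∑ ℓ ∈ Finset.univ.filter (fun ℓ => ℓ ≠ j ∧ ℓ ≠ i),
            (σ ℓ ^ 2)⁻¹ * B j ℓ * B i ℓ = 0) →
      (B i j = 0 ∧ B j i = 0 ∧ ∀ ℓ, ℓ ≠ j → ℓ ≠ i → B j ℓ * B i ℓ = 0)) :
    ∀ j i : Fin d, j ≠ i →
      (Θ j i ≠ 0 ↔
        B i j ≠ 0 ∨ B j i ≠ 0 ∨ ∃ ℓ, ℓ ≠ i ∧ ℓ ≠ j ∧ B j ℓ ≠ 0 ∧ B i ℓ ≠ 0) := by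
  intro j i hji
  have hinv : Ω⁻¹ = Matrix.diagonal fun ℓ => (σ ℓ ^ 2)⁻¹ := by
    apply Matrix.inv_eq_right_inv
    rw [hΩ, Matrix.diagonal_mul_diagonal, ← Matrix.diagonal_one]
    congr 1
    funext ℓ
    exact mul_inv_cancel₀ (pow_ne_zero 2 (hσ ℓ).ne')
  have key : Θ j i = -((σ j ^ 2)⁻¹ * B i j) - (σ i ^ 2)⁻¹ * B j i
        + ∑ ℓ ∈ Finset.univ.filter (fun ℓ => ℓ ≠ j ∧ ℓ ≠ i),
            (σ ℓ ^ 2)⁻¹ * B j ℓ * B i ℓ := by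
    have hterm : ∀ ℓ : Fin d, (1 - B) j ℓ * (σ ℓ ^ 2)⁻¹ * (1 - B) i ℓ
        = (if ℓ = j then -((σ j ^ 2)⁻¹ * B i j) else 0)
          + (if ℓ = i then -((σ i ^ 2)⁻¹ * B j i) else 0)
          + (if ℓ ≠ j ∧ ℓ ≠ i then (σ ℓ ^ 2)⁻¹ * B j ℓ * B i ℓ else 0) := by
      intro ℓ
      rw [Matrix.sub_apply, Matrix.sub_apply, Matrix.one_apply, Matrix.one_apply]
      by_cases h1 : ℓ = j
      · subst h1
        simp [hBdiag, hji, hji.symm]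
      · by_cases h2 : ℓ = i
        · subst h2
          simp [hBdiag, hji, hji.symm, mul_comm]
        · simp only [h1, h2, Ne.symm h1, Ne.symm h2, if_false, ne_eq, not_false_eq_true,
            and_self, if_true]
          ring
    rw [hΘ, hinv, Matrix.mul_apply]
    simp only [Matrix.mul_diagonal, Matrix.transpose_apply]
    rw [Finset.sum_congr rfl (fun ℓ _ => hterm ℓ), Finset.sum_add_distrib,
      Finset.sum_add_distrib, Finset.sum_ite_eq', Finset.sum_ite_eq', Finset.sum_filter]
    simp [sub_eq_add_neg]
  rw [key]
  constructor
  · intro h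
    by_contra hc
    push Not at hc
    obtain ⟨h1, h2, h3⟩ := hc
    apply h
    rw [h1, h2, Finset.sum_eq_zero]
    · simp
    · intro ℓ hℓ
      rw [Finset.mem_filter] at hℓ
      by_cases hb : B j ℓ = 0
      · simp [hb]
      · simp [h3 ℓ hℓ.2.2 hℓ.2.1 hb]
  · intro h h0
    obtain ⟨h1, h2, h3⟩ := hgeneric j i hji h0
    rcases h with h | h | ⟨ℓ, hi, hj, ha, hb⟩
    · exact h h1
    · exact h h2
    · exact mul_ne_zero ha hb (h3 ℓ hj hi)
end

section
/- Let d ≥ 1, let B be a d×d real matrix such that I − B is invertible, and set A := (I − B)⁻¹. Let S be a subset of the index set such that the principal submatrix A_{S,S} is invertible, and let i ∈ S be such that B_{i,j} = 0 for every j ∉ S. Then for every j ∈ S, the (i,j) entry of (A_{S,S})⁻¹ equals (I − B)_{i,j}; that is, row i of (A_{S,S})⁻¹ coincides with row i of I_S − B_{S,S}. -/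
open Matrix Finset

/-- If all parents of `i ∈ S` lie in `S`, then row `i` of `(A_{S,S})⁻¹` coincides with
row `i` of `I − B` restricted to `S`. -/
theorem row_of_inv_principal_submatrix (d : ℕ) (hd : 1 ≤ d)
    (B : Matrix (Fin d) (Fin d) ℝ) (hB : IsUnit (1 - B))
    (A : Matrix (Fin d) (Fin d) ℝ) (hA : A = (1 - B)⁻¹)
    (S : Finset (Fin d))
    (hASS : IsUnit (A.submatrix (Subtype.val : ↥S → Fin d) (Subtype.val : ↥S → Fin d)))
    (i : Fin d) (hi : i ∈ S) (hpar : ∀ j, j ∉ S → B i j = 0) :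
    ∀ (j : Fin d) (hj : j ∈ S),
      (A.submatrix (Subtype.val : ↥S → Fin d) (Subtype.val : ↥S → Fin d))⁻¹
        ⟨i, hi⟩ ⟨j, hj⟩ = (1 - B) i j := by
  intro j hj
  have hBA : (1 - B) * A = 1 := by
    rw [hA]
    exact Matrix.mul_nonsing_inv _ ((Matrix.isUnit_iff_isUnit_det _).mp hB)
  set M := A.submatrix (Subtype.val : ↥S → Fin d) (Subtype.val : ↥S → Fin d) with hM
  have hMM : M * M⁻¹ = 1 :=
    Matrix.mul_nonsing_inv _ ((Matrix.isUnit_iff_isUnit_det _).mp hASS)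
  have hv : (fun k : ↥S => (1 - B) i k.1) ᵥ* M = Pi.single (⟨i, hi⟩ : ↥S) (1 : ℝ) := by
    ext k
    have h1 : ∑ l, (1 - B) i l * A l k.1 = (1 : Matrix (Fin d) (Fin d) ℝ) i k.1 := by
      exact congrFun (congrFun hBA i) k.1
    have h2 : ∑ l ∈ S, (1 - B) i l * A l k.1 = ∑ l, (1 - B) i l * A l k.1 := by
      apply Finset.sum_subset (Finset.subset_univ S)
      intro l _ hl
      have hil : i ≠ l := fun h => hl (h ▸ hi)
      simp [Matrix.sub_apply, Matrix.one_apply_ne hil, hpar l hl]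
    have h3 : ((fun k : ↥S => (1 - B) i k.1) ᵥ* M) k
        = ∑ l ∈ S, (1 - B) i l * A l k.1 := by
      rw [← Finset.sum_coe_sort S]
      rfl
    rw [h3, h2, h1, Matrix.one_apply, Pi.single_apply]
    simp only [Subtype.ext_iff, eq_comm]
  have h4 := congrArg (fun w => (w ᵥ* M⁻¹) ⟨j, hj⟩) hv
  simp only [Matrix.vecMul_vecMul, hMM, Matrix.vecMul_one, Matrix.single_one_vecMul] at h4
  exact h4.symm
end

section
/- Let d ≥ 1, let B be a d×d real matrix such that I − B is invertible, and set A := (I − B)⁻¹. Let S be a subset of the index set such that the principal submatrix A_{S,S} is invertible, and let i ∈ S be such that B_{i,j} = 0 for every j ∉ S. Then for every vector e ∈ ℝ^d, writing x := A e, one has Σ_{j ∈ S} ((A_{S,S})⁻¹)_{i,j} x_j = e_i; that is, applying (A_{S,S})⁻¹ to the restriction of x to S exactly recovers the i-th source component e_i. -/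
open Matrix Finset

/-- If all parents of `i ∈ S` lie in `S`, then applying row `i` of `(A_{S,S})⁻¹` to the
restriction of `x = A e` to `S` exactly recovers the source component `e i`. -/
theorem local_demixing_recovers_noise (d : ℕ) (hd : 1 ≤ d)
    (B : Matrix (Fin d) (Fin d) ℝ) (hB : IsUnit (1 - B))
    (A : Matrix (Fin d) (Fin d) ℝ) (hA : A = (1 - B)⁻¹)
    (S : Finset (Fin d))
    (hASS : IsUnit (A.submatrix (Subtype.val : ↥S → Fin d) (Subtype.val : ↥S → Fin d)))
    (i : Fin d) (hi : i ∈ S) (hpar : ∀ j, j ∉ S → B i j = 0) :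
    ∀ e : Fin d → ℝ,
      ∑ j : ↥S,
        (A.submatrix (Subtype.val : ↥S → Fin d) (Subtype.val : ↥S → Fin d))⁻¹
          ⟨i, hi⟩ j * A.mulVec e j.1 = e i := by
  intro e
  have hdet : IsUnit (1 - B).det := (Matrix.isUnit_iff_isUnit_det _).1 hB
  have hmul : (1 - B) * A = 1 := by rw [hA]; exact Matrix.mul_nonsing_inv _ hdet
  have key : ∀ y : Fin d → ℝ,
      ∑ j : ↥S, (1 - B) i j.1 * y j.1 = ∑ j, (1 - B) i j * y j := by
    intro y
    rw [Finset.sum_coe_sort S (fun j => (1 - B) i j * y j)]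
    apply Finset.sum_subset (Finset.subset_univ S)
    intro j _ hj
    have hne : i ≠ j := fun h => hj (h ▸ hi)
    simp [Matrix.sub_apply, Matrix.one_apply_ne hne, hpar j hj]
  set M := A.submatrix (Subtype.val : ↥S → Fin d) (Subtype.val : ↥S → Fin d) with hM
  have hMdet : IsUnit M.det := (Matrix.isUnit_iff_isUnit_det _).1 hASS
  have hw : (fun j : ↥S => (1 - B) i j.1) ᵥ* M = Pi.single (⟨i, hi⟩ : ↥S) 1 := by
    funext k
    have h1 := key (fun j => A j k.1)
    have h2 : ∑ j, (1 - B) i j * A j k.1 = (1 : Matrix (Fin d) (Fin d) ℝ) i k.1 := by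
      rw [← Matrix.mul_apply, hmul]
    have h3 : ((fun j : ↥S => (1 - B) i j.1) ᵥ* M) k
        = ∑ j : ↥S, (1 - B) i j.1 * A j.1 k.1 := rfl
    rw [h3, h1, h2, Matrix.one_apply, Pi.single_apply]
    congr 1
    simp only [Subtype.ext_iff, eq_comm]
  have hrow : ∀ j : ↥S, M⁻¹ ⟨i, hi⟩ j = (1 - B) i j.1 := by
    intro j
    have h4 := congrArg (fun v => (v ᵥ* M⁻¹) j) hw
    simp only [Matrix.vecMul_vecMul, Matrix.mul_nonsing_inv _ hMdet, Matrix.vecMul_one,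
      Matrix.single_one_vecMul] at h4
    exact h4.symm
  simp only [hrow]
  rw [key (A *ᵥ e)]
  have h5 : ((1 - B) *ᵥ (A *ᵥ e)) i = e i := by
    rw [Matrix.mulVec_mulVec, hmul, Matrix.one_mulVec]
  exact h5
end

section
/- Let d ≥ 1, let B be a d×d real matrix such that I − B is invertible, and set A := (I − B)⁻¹. Let i ≠ j be indices such that there is no directed path from i to j in the directed graph of B, i.e., the transitive closure of the relation (a, b) ↦ B_{b,a} ≠ 0 does not relate i to j. Then A_{j,i} = 0. -/
open Matrix Finset

/-- If there is no directed path from `i` to `j` in the graph of `B` (edge `a → b` iff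
`B b a ≠ 0`), then the total effect `A j i` of `i` on `j` vanishes, where
`A = (I − B)⁻¹`. -/
theorem total_effect_zero_of_no_path (d : ℕ) (hd : 1 ≤ d)
    (B : Matrix (Fin d) (Fin d) ℝ) (hB : IsUnit (1 - B))
    (A : Matrix (Fin d) (Fin d) ℝ) (hA : A = (1 - B)⁻¹)
    (i j : Fin d) (hij : i ≠ j)
    (hpath : ¬ Relation.TransGen (fun a b => B b a ≠ 0) i j) :
    A j i = 0 := by
  classical
  let R : Fin d → Prop := Relation.ReflTransGen (fun a b => B b a ≠ 0) i
  let b : Fin d → ℕ := fun k => if R k then 0 else 1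
  have hb : ∀ r c, b c < b r → R c ∧ ¬ R r := by
    intro r c h
    by_cases hc : R c <;> by_cases hr : R r <;> simp_all [b]
  have hM : BlockTriangular (1 - B) b := by
    intro r c h
    obtain ⟨hc, hr⟩ := hb r c h
    have hrc : r ≠ c := fun e => hr (e ▸ hc)
    have hB0 : B r c = 0 := by
      by_contra hne
      exact hr (Relation.ReflTransGen.tail hc hne)
    simp [Matrix.one_apply_ne hrc, hB0]
  haveI : Invertible (1 - B) := hB.invertible
  have hinv := blockTriangular_inv_of_blockTriangular hM
  have hi : R i := Relation.ReflTransGen.refl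
  have hj : ¬ R j := by
    intro h
    rcases Relation.reflTransGen_iff_eq_or_transGen.mp h with h | h
    · exact hij h.symm
    · exact hpath h
  rw [hA]
  apply hinv
  simp [b, hi, hj]
end

section
/- Let d ≥ 1, let B be a d×d real matrix with zero diagonal such that I − B is invertible, set A := (I − B)⁻¹, let σ_1,…,σ_d be positive reals, let Ω be the diagonal matrix with entries σ_1²,…,σ_d², and let Σ := A Ω Aᵀ. Let S be a subset of the index set and let i ∉ S be an index such that B_{i,j} = 0 for every j ∉ S, and such that for every j ∈ S there is no directed path from i to j in the directed graph of B (i.e., the transitive closure of the relation (a, b) ↦ B_{b,a} ≠ 0 does not relate i to j). Then: (a) the principal submatrix Σ_{S,S} is positive definite; (b) for every j ∈ S, Σ_{ℓ ∈ S} Σ_{j,ℓ} B_{i,ℓ} = Σ_{j,i}, so that the population least-squares coefficient vector (Σ_{S,S})⁻¹ Σ_{S,i} of regressing X_i on X_S equals (B_{i,ℓ})_{ℓ∈S}; and (c) for every vector e ∈ ℝ^d, writing x := A e, the residual x_i − Σ_{j ∈ S} B_{i,j} x_j equals e_i. -/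
open Matrix Finset

/-- If all parents of `i` lie in `S` and `S` contains no descendants of `i`, then:
(a) the principal submatrix `Σ_{S,S}` of the covariance `Σ = A Ω Aᵀ` is positive
definite; (b) the population least-squares coefficients of regressing `X_i` on `X_S`
equal the direct effects `(B i ℓ)_{ℓ ∈ S}`; (c) the regression residual recovers the
exogenous noise `e i`. -/
theorem regression_on_nondescendants (d : ℕ) (hd : 1 ≤ d)
    (B : Matrix (Fin d) (Fin d) ℝ) (hBdiag : ∀ i, B i i = 0) (hB : IsUnit (1 - B))
    (A : Matrix (Fin d) (Fin d) ℝ) (hA : A = (1 - B)⁻¹)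
    (σ : Fin d → ℝ) (hσ : ∀ i, 0 < σ i)
    (Ω Cov : Matrix (Fin d) (Fin d) ℝ)
    (hΩ : Ω = Matrix.diagonal fun ℓ => σ ℓ ^ 2) (hCov : Cov = A * Ω * Aᵀ)
    (S : Finset (Fin d)) (i : Fin d) (hiS : i ∉ S)
    (hpar : ∀ j, j ∉ S → B i j = 0)
    (hpath : ∀ j ∈ S, ¬ Relation.TransGen (fun a b => B b a ≠ 0) i j) :
    (Cov.submatrix (Subtype.val : ↥S → Fin d) (Subtype.val : ↥S → Fin d)).PosDef
    ∧ (∀ j ∈ S, ∑ ℓ ∈ S, Cov j ℓ * B i ℓ = Cov j i)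
    ∧ ((Cov.submatrix (Subtype.val : ↥S → Fin d) (Subtype.val : ↥S → Fin d))⁻¹.mulVec
        (fun j : ↥S => Cov j.1 i) = fun ℓ : ↥S => B i ℓ.1)
    ∧ ∀ e : Fin d → ℝ, A.mulVec e i - ∑ j ∈ S, B i j * A.mulVec e j = e i := by
  have hdet : IsUnit (1 - B).det := (Matrix.isUnit_iff_isUnit_det _).mp hB
  have h1 : (1 - B) * A = 1 := by rw [hA]; exact Matrix.mul_nonsing_inv _ hdet
  have h2 : A * (1 - B) = 1 := by rw [hA]; exact Matrix.nonsing_inv_mul _ hdet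
  have hsum : ∀ v : Fin d → ℝ, ∑ j ∈ S, B i j * v j = ∑ j, B i j * v j := by
    intro v
    apply Finset.sum_subset (Finset.subset_univ S)
    intro j _ hj
    rw [hpar j hj, zero_mul]
  have hAzero : ∀ j ∈ S, A j i = 0 := by
    classical
    let R : Fin d → Fin d → Prop := fun a b => B b a ≠ 0
    let b : Fin d → ℕ := fun k => if Relation.ReflTransGen R i k then 0 else 1
    have hbt : (1 - B).BlockTriangular b := by
      intro r c hrc
      have hc : Relation.ReflTransGen R i c := by
        by_contra h
        simp only [b, if_neg h] at hrc
        split_ifs at hrc <;> omega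
      have hr : ¬ Relation.ReflTransGen R i r := by
        intro h
        simp only [b, if_pos h] at hrc
        omega
      have hne : r ≠ c := by rintro rfl; exact hr hc
      have hB0 : B r c = 0 := by
        by_contra h
        exact hr (hc.tail h)
      simp [Matrix.sub_apply, Matrix.one_apply_ne hne, hB0]
    letI : Invertible (1 - B) := hB.invertible
    have hinv := Matrix.blockTriangular_inv_of_blockTriangular hbt
    rw [← hA] at hinv
    intro j hj
    apply hinv
    have hji : ¬ Relation.ReflTransGen R i j := by
      intro h
      rcases Relation.reflTransGen_iff_eq_or_transGen.mp h with h | h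
      · exact hiS (h ▸ hj)
      · exact hpath j hj h
    simp only [b, if_neg hji, if_pos Relation.ReflTransGen.refl]
    exact Nat.zero_lt_one
  have hPD : Cov.PosDef := by
    have hΩP : Ω.PosDef := by
      rw [hΩ]
      exact Matrix.PosDef.diagonal fun k => pow_pos (hσ k) 2
    rw [hCov, ← Matrix.conjTranspose_eq_transpose_of_trivial]
    apply hΩP.mul_mul_conjTranspose_same
    intro v w hvw
    have := congrArg (fun u => u ᵥ* (1 - B)) hvw
    simpa [Matrix.vecMul_vecMul, h2] using this
  have hsub := hPD.submatrix (e := (Subtype.val : ↥S → Fin d)) Subtype.val_injective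
  have hb : ∀ j ∈ S, ∑ ℓ ∈ S, Cov j ℓ * B i ℓ = Cov j i := by
    intro j hj
    have h3 : Cov * (1 - B)ᵀ = A * Ω := by
      rw [hCov, Matrix.mul_assoc, ← Matrix.transpose_mul, h1, Matrix.transpose_one,
        Matrix.mul_one]
    have h4 := congrFun (congrFun h3 j) i
    rw [hΩ, Matrix.mul_diagonal, hAzero j hj, zero_mul, Matrix.transpose_sub, Matrix.mul_sub,
      Matrix.transpose_one, Matrix.mul_one, Matrix.sub_apply, Matrix.mul_apply] at h4
    have h5 := hsum (fun ℓ => Cov j ℓ)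
    simp only [mul_comm (B i _)] at h5
    simp only [Matrix.transpose_apply] at h4
    linarith
  refine ⟨hsub, hb, ?_, ?_⟩
  · have hu := (Matrix.isUnit_iff_isUnit_det _).mp hsub.isUnit
    have h6 : (fun j : ↥S => Cov j.1 i) =
        (Cov.submatrix (Subtype.val : ↥S → Fin d) (Subtype.val : ↥S → Fin d)).mulVec
          (fun ℓ : ↥S => B i ℓ.1) := by
      funext j
      rw [← hb j.1 j.2, ← Finset.sum_coe_sort]
      rfl
    rw [h6, Matrix.mulVec_mulVec, Matrix.nonsing_inv_mul _ hu, Matrix.one_mulVec]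
  · intro e
    rw [hsum]
    have h7 : (1 - B).mulVec (A.mulVec e) = e := by
      rw [Matrix.mulVec_mulVec, h1, Matrix.one_mulVec]
    have h8 := congrFun h7 i
    rw [Matrix.sub_mulVec, Matrix.one_mulVec] at h8
    exact h8
end

section
/- Let m ≥ 1, let C be an invertible m×m real matrix, let Γ be a partition of the index set {1,…,m}, and let τ be a permutation of {1,…,m}. Suppose there exists an m×m real matrix D that is a general scaling matrix consistent with Γ (meaning: for every block S ∈ Γ, the principal submatrix D_{S,S} is invertible, and D_{S,ℓ} = 0 whenever ℓ ∉ S) such that, for every block S ∈ Γ, the principal submatrix of P^τ D C with rows and columns indexed by τ⁻¹(S) is invertible, where P^τ is the permutation matrix with (P^τ M)_{i,·} = M_{τ(i),·}. Then there exists a permutation π of {1,…,m} such that C_{π(i),i} ≠ 0 for every i (i.e., P^π C has all nonzero diagonal entries), and such that π⁻¹(S) = τ⁻¹(S) as sets for every block S ∈ Γ. -/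
open Matrix Finset

/-- A general scaling matrix consistent with a partition `Γ`: every principal block
`D_{S,S}` (for `S ∈ Γ`) is invertible, and all entries with row in a block `S` and
column outside `S` vanish. -/
def IsGeneralScaling {m : ℕ} (Γ : Finpartition (Finset.univ : Finset (Fin m)))
    (D : Matrix (Fin m) (Fin m) ℝ) : Prop :=
  (∀ S ∈ Γ.parts,
    IsUnit (D.submatrix (Subtype.val : ↥S → Fin m) (Subtype.val : ↥S → Fin m))) ∧
  ∀ S ∈ Γ.parts, ∀ i ∈ S, ∀ ℓ, ℓ ∉ S → D i ℓ = 0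

lemma block_local {m : ℕ} (C D : Matrix (Fin m) (Fin m) ℝ) (τ : Equiv.Perm (Fin m))
    (S : Finset (Fin m)) (h0 : ∀ i ∈ S, ∀ l, l ∉ S → D i l = 0)
    (hU : IsUnit (((D * C).submatrix (⇑τ) id).submatrix
          (Subtype.val : ↥(S.image ⇑τ.symm) → Fin m)
          (Subtype.val : ↥(S.image ⇑τ.symm) → Fin m))) :
    ∃ g : Fin m → Fin m, (∀ i, τ i ∈ S → g i ∈ S ∧ C (g i) i ≠ 0) ∧
      ∀ i j, τ i ∈ S → τ j ∈ S → g i = g j → i = j := by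
  have hT : ∀ x, x ∈ S.image ⇑τ.symm ↔ τ x ∈ S := by
    intro x
    simp only [Finset.mem_image]
    constructor
    · rintro ⟨y, hy, rfl⟩
      simpa using hy
    · intro h
      exact ⟨τ x, h, by simp⟩
  generalize S.image ⇑τ.symm = T at hU hT
  let A : Matrix T T ℝ := Matrix.of fun i k => D (τ i) (τ k)
  let B : Matrix T T ℝ := Matrix.of fun k j => C (τ k) j
  have hM : ((D * C).submatrix (⇑τ) id).submatrix
          (Subtype.val : T → Fin m) (Subtype.val : T → Fin m) = A * B := by
    ext i j
    simp only [Matrix.submatrix_apply, Matrix.mul_apply, id, A, B, Matrix.of_apply]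
    rw [← Equiv.sum_comp τ, Finset.sum_coe_sort T (fun k => D (τ i) (τ k) * C (τ k) j)]
    symm
    apply Finset.sum_subset (Finset.subset_univ _)
    intro x _ hx
    rw [h0 (τ i) ((hT _).1 i.2) (τ x) (fun h => hx ((hT _).2 h)), zero_mul]
  rw [hM, Matrix.isUnit_iff_isUnit_det, Matrix.det_mul] at hU
  have hB : B.det ≠ 0 := fun h => by simp [h] at hU
  rw [Matrix.det_apply] at hB
  obtain ⟨σ, -, hσ⟩ := Finset.exists_ne_zero_of_sum_ne_zero hB
  have hp : ∀ i, B (σ i) i ≠ 0 := by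
    intro i hi
    apply hσ
    have hz : ∏ i, B (σ i) i = 0 := Finset.prod_eq_zero (Finset.mem_univ i) hi
    rw [hz, smul_zero]
  refine ⟨fun i => if h : i ∈ T then τ (σ ⟨i, h⟩) else i, ?_, ?_⟩
  · intro i hi
    have h := (hT i).2 hi
    simp only [h, dif_pos]
    exact ⟨(hT _).1 (σ ⟨i, h⟩).2, hp ⟨i, h⟩⟩
  · intro i j hi hj hij
    have h := (hT i).2 hi
    have h' := (hT j).2 hj
    simp only [h, h', dif_pos] at hij
    have := σ.injective (Subtype.ext (τ.injective hij))
    exact congrArg Subtype.val this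

/-- If for some general scaling matrix `D` consistent with `Γ` the permutation `τ` makes
all diagonal blocks of `P^τ D C` (indexed by `τ⁻¹(S)` for blocks `S ∈ Γ`) invertible,
then there is a permutation `π` with all diagonal entries of `P^π C` nonzero that is
groupwise equivalent to `τ` with respect to `Γ`. -/
theorem admissible_block_perm_to_nonzero_diag_perm (m : ℕ) (hm : 1 ≤ m)
    (C : Matrix (Fin m) (Fin m) ℝ) (hC : IsUnit C)
    (Γ : Finpartition (Finset.univ : Finset (Fin m))) (τ : Equiv.Perm (Fin m))
    (hD : ∃ D : Matrix (Fin m) (Fin m) ℝ, IsGeneralScaling Γ D ∧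
      ∀ S ∈ Γ.parts,
        IsUnit (((D * C).submatrix (⇑τ) id).submatrix
          (Subtype.val : ↥(S.image ⇑τ.symm) → Fin m)
          (Subtype.val : ↥(S.image ⇑τ.symm) → Fin m))) :
    ∃ π : Equiv.Perm (Fin m), (∀ i : Fin m, C (π i) i ≠ 0) ∧
      ∀ S ∈ Γ.parts, S.image ⇑π.symm = S.image ⇑τ.symm := by
  obtain ⟨D, ⟨-, h0⟩, hU⟩ := hD
  haveI : Nonempty (Fin m → Fin m) := ⟨id⟩
  choose! g hg hinj using fun S hS => block_local C D τ S (h0 S hS) (hU S hS)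
  have hmem : ∀ x, Γ.part x ∈ Γ.parts := fun x => Γ.part_mem.2 (Finset.mem_univ x)
  have hself : ∀ x, x ∈ Γ.part x := fun x => Γ.mem_part (Finset.mem_univ x)
  let f : Fin m → Fin m := fun i => g (Γ.part (τ i)) i
  have hf : ∀ i, f i ∈ Γ.part (τ i) ∧ C (f i) i ≠ 0 := fun i =>
    hg _ (hmem _) i (hself _)
  have hpart : ∀ i, Γ.part (f i) = Γ.part (τ i) := fun i =>
    Γ.part_eq_of_mem (hmem _) (hf i).1
  have hfi : Function.Injective f := by
    intro i j hij
    have hp : Γ.part (τ j) = Γ.part (τ i) := by rw [← hpart, ← hpart, hij]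
    refine hinj (Γ.part (τ i)) (hmem _) i j (hself _) (hp ▸ hself _) ?_
    have h2 : g (Γ.part (τ i)) i = g (Γ.part (τ j)) j := hij
    rwa [hp] at h2
  refine ⟨Equiv.ofBijective f (Finite.injective_iff_bijective.1 hfi), fun i => (hf i).2, ?_⟩
  intro S hS
  have hT : ∀ (ρ : Equiv.Perm (Fin m)) x, x ∈ S.image ⇑ρ.symm ↔ ρ x ∈ S := by
    intro ρ x
    simp only [Finset.mem_image]
    constructor
    · rintro ⟨y, hy, rfl⟩
      simpa using hy
    · intro h
      exact ⟨ρ x, h, by simp⟩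
  ext x
  rw [hT, hT, Equiv.ofBijective_apply]
  constructor
  · intro h
    have := Γ.part_eq_of_mem hS h
    rw [← this, hpart]
    exact hself _
  · intro h
    have := Γ.part_eq_of_mem hS h
    rw [← this]
    exact (hf x).1
end

section
/- Let m ≥ 1, let C be an invertible m×m real matrix, let Γ be a partition of the index set {1,…,m}, and let π be a permutation of {1,…,m} such that C_{π(i),i} ≠ 0 for every i (i.e., P^π C has all nonzero diagonal entries) and such that, for every block S ∈ Γ, the principal submatrix of P^π C with rows and columns indexed by π⁻¹(S) is invertible, where P^π is the permutation matrix with (P^π M)_{i,·} = M_{π(i),·}. Then for every general scaling matrix D consistent with Γ (meaning: for every block S ∈ Γ, D_{S,S} is invertible and D_{S,ℓ} = 0 whenever ℓ ∉ S) and for every block S ∈ Γ, the principal submatrix of P^π D C with rows and columns indexed by π⁻¹(S) is invertible. -/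
open Matrix Finset

/-- If `π` gives `P^π C` nonzero diagonal entries and all diagonal blocks of `P^π C`
indexed by `π⁻¹(S)` (for blocks `S ∈ Γ`) are invertible, then for every general scaling
matrix `D` consistent with `Γ`, the corresponding diagonal blocks of `P^π D C` are also
invertible. -/
theorem nonzero_diag_perm_is_admissible_block_perm (m : ℕ) (hm : 1 ≤ m)
    (C : Matrix (Fin m) (Fin m) ℝ) (hC : IsUnit C)
    (Γ : Finpartition (Finset.univ : Finset (Fin m))) (π : Equiv.Perm (Fin m))
    (hdiag : ∀ i : Fin m, C (π i) i ≠ 0)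
    (hblocks : ∀ S ∈ Γ.parts,
      IsUnit ((C.submatrix (⇑π) id).submatrix
        (Subtype.val : ↥(S.image ⇑π.symm) → Fin m)
        (Subtype.val : ↥(S.image ⇑π.symm) → Fin m))) :
    ∀ D : Matrix (Fin m) (Fin m) ℝ, IsGeneralScaling Γ D →
      ∀ S ∈ Γ.parts,
        IsUnit (((D * C).submatrix (⇑π) id).submatrix
          (Subtype.val : ↥(S.image ⇑π.symm) → Fin m)
          (Subtype.val : ↥(S.image ⇑π.symm) → Fin m)) := by
  intro D hD S hS
  obtain ⟨hD1, hD2⟩ := hD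
  have hmem : ∀ a : Fin m, a ∈ S.image ⇑π.symm ↔ π a ∈ S := by
    intro a
    simp only [Finset.mem_image]
    constructor
    · rintro ⟨b, hb, rfl⟩
      simpa using hb
    · intro h
      exact ⟨π a, h, by simp⟩
  let e : ↥(S.image ⇑π.symm) ≃ ↥S := π.subtypeEquiv hmem
  have key : ((D * C).submatrix (⇑π) id).submatrix
          (Subtype.val : ↥(S.image ⇑π.symm) → Fin m)
          (Subtype.val : ↥(S.image ⇑π.symm) → Fin m)
      = ((D.submatrix (Subtype.val : ↥S → Fin m) (Subtype.val : ↥S → Fin m)).submatrix e e) *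
        ((C.submatrix (⇑π) id).submatrix
          (Subtype.val : ↥(S.image ⇑π.symm) → Fin m)
          (Subtype.val : ↥(S.image ⇑π.symm) → Fin m)) := by
    ext i j
    have hi : π i.1 ∈ S := (hmem i.1).1 i.2
    simp only [Matrix.submatrix_apply, Matrix.mul_apply, id]
    have h1 : ∑ k, D (π i.1) k * C k j.1 = ∑ k ∈ S, D (π i.1) k * C k j.1 := by
      symm
      apply Finset.sum_subset (Finset.subset_univ S)
      intro k _ hk
      rw [hD2 S hS _ hi k hk, zero_mul]
    rw [h1, ← Finset.sum_coe_sort S (fun k => D (π i.1) k * C k j.1)]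
    exact (Equiv.sum_comp e (fun k : ↥S => D (π i.1) k.1 * C k.1 j.1)).symm
  rw [key]
  refine IsUnit.mul ?_ (hblocks S hS)
  exact (Matrix.isUnit_submatrix_equiv e e).2 (hD1 S hS)
end

section
/- Let m ≥ 1, let C be an invertible m×m real matrix, and let Γ be a partition of the index set {1,…,m}. Then there exists a permutation ρ of {1,…,m} such that for every block S ∈ Γ, the square matrix indexed by S × S whose (a,b) entry is C_{a, ρ(b)} is invertible; that is, for every block S, the submatrix of C with rows S and columns ρ(S) (reindexed along ρ) is invertible. -/
open Matrix Finset

/-- Blockwise version of the nonzero-diagonal permutation: for an invertible matrix `C`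
and a partition `Γ` of the index set, there is a permutation `ρ` such that for every
block `S ∈ Γ`, the square matrix `(a, b) ↦ C a (ρ b)` indexed by `S × S` is
invertible. -/
theorem exists_perm_invertible_diagonal_blocks (m : ℕ) (hm : 1 ≤ m)
    (C : Matrix (Fin m) (Fin m) ℝ) (hC : IsUnit C)
    (Γ : Finpartition (Finset.univ : Finset (Fin m))) :
    ∃ ρ : Equiv.Perm (Fin m), ∀ S ∈ Γ.parts,
      IsUnit (Matrix.of fun a b : ↥S => C a.1 (ρ b.1)) := by
  classical
  have hdet : C.det ≠ 0 := ((Matrix.isUnit_iff_isUnit_det C).1 hC).ne_zero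
  let r : Fin m → Fin m → Prop := fun i j => ∃ S ∈ Γ.parts, i ∈ S ∧ j ∈ S
  let M : Equiv.Perm (Fin m) → Matrix (Fin m) (Fin m) ℝ := fun ρ =>
    Matrix.of fun i j => if r i j then C i (ρ j) else 0
  let g : Equiv.Perm (Fin m) → ℝ := fun τ => if ∀ i, r (τ i) i then 1 else 0
  have hM : ∀ ρ, (M ρ).det = ∑ τ : Equiv.Perm (Fin m),
      ((Equiv.Perm.sign τ : ℤ) : ℝ) * (g τ * ∏ i, C (τ i) (ρ i)) := by
    intro ρ
    rw [Matrix.det_apply']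
    refine Finset.sum_congr rfl fun τ _ => ?_
    congr 1
    simp only [M, g, Matrix.of_apply]
    rw [Finset.prod_ite_zero]
    simp
  have hD : ∀ τ : Equiv.Perm (Fin m), ∑ ρ : Equiv.Perm (Fin m),
      ((Equiv.Perm.sign ρ : ℤ) : ℝ) * ∏ i, C (τ i) (ρ i)
        = ((Equiv.Perm.sign τ : ℤ) : ℝ) * C.det := by
    intro τ
    rw [← Matrix.det_permute, ← Matrix.det_transpose, Matrix.det_apply']
    rfl
  have hsum : ∑ ρ : Equiv.Perm (Fin m), ((Equiv.Perm.sign ρ : ℤ) : ℝ) * (M ρ).det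
      = (∑ τ, g τ) * C.det := by
    simp only [hM, Finset.mul_sum]
    rw [Finset.sum_comm, Finset.sum_mul]
    refine Finset.sum_congr rfl fun τ _ => ?_
    have hs : ((Equiv.Perm.sign τ : ℤ) : ℝ) * ((Equiv.Perm.sign τ : ℤ) : ℝ) = 1 := by
      rcases Int.units_eq_one_or (Equiv.Perm.sign τ) with h | h <;> simp [h]
    calc _ = ((Equiv.Perm.sign τ : ℤ) : ℝ) * g τ * ∑ ρ : Equiv.Perm (Fin m),
          ((Equiv.Perm.sign ρ : ℤ) : ℝ) * ∏ i, C (τ i) (ρ i) := by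
            rw [Finset.mul_sum]
            exact Finset.sum_congr rfl fun ρ _ => by ring
      _ = _ := by rw [hD]; linear_combination (g τ * C.det) * hs
  have hg1 : g 1 = 1 := by
    have : ∀ i, r i i := fun i => by
      obtain ⟨S, hS, hi⟩ := Γ.exists_mem (Finset.mem_univ i)
      exact ⟨S, hS, hi, hi⟩
    simp [g, this]
  have hgpos : 0 < ∑ τ, g τ := by
    have h0 : ∀ τ ∈ (Finset.univ : Finset (Equiv.Perm (Fin m))), 0 ≤ g τ := by
      intro τ _
      simp only [g]
      split_ifs <;> norm_num
    have := Finset.single_le_sum h0 (Finset.mem_univ 1)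
    linarith
  obtain ⟨ρ, hρ⟩ : ∃ ρ, (M ρ).det ≠ 0 := by
    by_contra! h
    simp only [h, mul_zero, Finset.sum_const_zero] at hsum
    exact mul_ne_zero hgpos.ne' hdet hsum.symm
  refine ⟨ρ, fun S hS => ?_⟩
  rw [Matrix.isUnit_iff_isUnit_det, isUnit_iff_ne_zero]
  rw [Matrix.twoBlockTriangular_det (M ρ) (fun i => i ∈ S) ?_] at hρ
  · have h1 := left_ne_zero_of_mul hρ
    have h2 : (Matrix.of fun a b : ↥S => C a.1 (ρ b.1))
        = Matrix.toSquareBlockProp (M ρ) (fun i => i ∈ S) := by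
      ext a b
      have : r a.1 b.1 := ⟨S, hS, a.2, b.2⟩
      simp [Matrix.toSquareBlockProp, M, this]
    rw [h2]
    convert h1
  · intro i hi j hj
    have : ¬ r i j := by
      rintro ⟨T, hT, hiT, hjT⟩
      have := Γ.eq_of_mem_parts hT hS hjT hj
      exact hi (this ▸ hiT)
    simp [M, this]
end
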